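/- arXiv:2101.04058 — 2 statements merged into one kernel-verified Lean document; each statement's English description precedes it below -/
import Mathlib

section
/- For all integers n ≥ 0 and k ≥ 2, the quantity PD_k(n) + Σ PD_k(n − ℓ²), where the sum ranges over all integers ℓ ≥ 1 with 3 ∤ ℓ and ℓ² ≤ n, is odd if n = 0 or n = k m² for some integer m ≥ 1 with 3 ∤ m, and is even otherwise. -/
/-- `PD k n` is the number of partitions of `n` with designated summands whose parts are
not divisible by `k`: the sum over partitions of `n` with no part divisible by `k` of the
product of the multiplicities of the distinct part sizes. -/
def PD (k n : ℕ) : ℕ :=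
  ∑ p : n.Partition,
    if ∀ s ∈ p.parts, ¬ k ∣ s then ∏ s ∈ p.parts.toFinset, p.parts.count s else 0

open PowerSeries PowerSeries.WithPiTopology Filter

open Classical in
/-- The power series over `ZMod 2` whose coefficients are the indicator function of `p`. -/
noncomputable def indicatorSeries (p : ℕ → Prop) : (ZMod 2)⟦X⟧ :=
  .mk fun n ↦ if p n then 1 else 0

theorem ZMod.powerSeries_two_eq_zero : (2 : (ZMod 2)⟦X⟧) = 0 := by
  rw [← map_ofNat (C (R := ZMod 2)) 2, show (OfNat.ofNat 2 : ZMod 2) = 0 from rfl, map_zero]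

/-- Over `ZMod 2`, substituting `X ^ 2` for `X` is the same as squaring. -/
theorem ZMod.expand_two (f : (ZMod 2)⟦X⟧) : expand 2 two_ne_zero f = f ^ 2 := by
  have h := MvPowerSeries.map_frobenius_expand (R := ZMod 2) 2 two_ne_zero (f := f)
  rw [ZMod.frobenius_zmod] at h
  simpa [expand] using h

/-- The generalized pentagonal numbers are the `n` for which `24 n + 1` is a square. -/
theorem mem_range_pentagonal_iff (n : ℕ) : n ∈ Set.range pentagonal ↔ IsSquare (24 * n + 1) := by
  constructor
  · rintro ⟨k, rfl⟩
    have h := two_mul_natCast_pentagonal k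
    refine ⟨(6 * k - 1).natAbs, ?_⟩
    zify
    rw [← abs_mul, abs_of_nonneg (mul_self_nonneg _)]
    linear_combination 12 * h
  · rintro ⟨m, hm⟩
    have hm6 : m % 6 = 1 ∨ m % 6 = 5 := by
      have h6 : (m * m) % 6 = 1 := by omega
      have : m % 6 < 6 := Nat.mod_lt _ (by norm_num)
      rw [Nat.mul_mod] at h6
      interval_cases m % 6 <;> simp_all
    have key (k : ℤ) (hk : ((6 * k - 1) ^ 2 : ℤ) = m ^ 2) : n ∈ Set.range pentagonal := by
      refine ⟨k, ?_⟩
      have h := two_mul_natCast_pentagonal k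
      zify at hm ⊢
      linarith
    rcases hm6 with h | h
    · refine key (-(m / 6 : ℕ)) ?_
      have : m = 6 * (m / 6) + 1 := by omega
      zify at this ⊢
      generalize (m : ℤ) / 6 = t at *
      rw [this]; ring
    · refine key ((m / 6 : ℕ) + 1) ?_
      have : m = 6 * (m / 6) + 5 := by omega
      zify at this ⊢
      generalize (m : ℤ) / 6 = t at *
      rw [this]; ring

theorem pentagonalSeries_eq_indicatorSeries :
    pentagonalSeries (ZMod 2) = indicatorSeries fun n ↦ IsSquare (24 * n + 1) := by
  ext n
  rw [indicatorSeries, coeff_mk, ← mem_range_pentagonal_iff]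
  split_ifs with h
  · obtain ⟨k, rfl⟩ := h
    rw [coeff_pentagonalSeries_pentagonal]
    rcases Int.units_eq_one_or k.negOnePow with h | h <;> rw [h] <;> rfl
  · exact coeff_pentagonalSeries_eq_zero _ h

/-- A finite form of Gauss's identity for the generating function of the triangular numbers. -/
theorem prod_mul_sum_pow_triangular {R : Type*} [CommRing R] (x : R) (n : ℕ) :
    (∏ i ∈ Finset.range n, (1 - x ^ (2 * i + 1))) *
        ∑ s ∈ Finset.range (2 * n + 1), x ^ (s * (s + 1) / 2) =
      ∑ s ∈ Finset.range (n + 1), (∏ i ∈ Finset.range s, (1 - x ^ (2 * i + 1))) *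
        (∏ i ∈ Finset.Ico s n, (1 - x ^ (2 * (i + 1)))) * x ^ (s * (2 * n + 1)) := by
  induction n with
  | zero => simp
  | succ n ih =>
    have telescope (m : ℕ) (hm : m ≤ n) :
        ∑ s ∈ Finset.range (m + 1), (∏ i ∈ Finset.range s, (1 - x ^ (2 * i + 1))) *
            (∏ i ∈ Finset.Ico s n, (1 - x ^ (2 * (i + 1)))) * x ^ (s * (2 * n + 1)) *
            ((1 - x ^ (2 * n + 2)) * x ^ (2 * s) - (1 - x ^ (2 * n + 1))) =
          (∏ i ∈ Finset.range (m + 1), (1 - x ^ (2 * i + 1))) *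
            (∏ i ∈ Finset.Ico m n, (1 - x ^ (2 * (i + 1)))) * x ^ ((m + 1) * (2 * n + 1)) := by
      induction m with
      | zero => simp; ring
      | succ m ihm =>
        rw [Finset.sum_range_succ, ihm (by omega), Finset.prod_range_succ _ (m + 1),
          Finset.prod_eq_prod_Ico_succ_bot (show m < n by omega)]
        ring
    have tri_odd : (2 * n + 1) * (2 * n + 1 + 1) / 2 = (n + 1) * (2 * n + 1) :=
      Nat.div_eq_of_eq_mul_left two_pos (by ring)
    have tri_even : (2 * n + 1 + 1) * (2 * n + 1 + 1 + 1) / 2 = (n + 1) * (2 * n + 3) :=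
      Nat.div_eq_of_eq_mul_left two_pos (by ring)
    have ht := telescope n le_rfl
    rw [Finset.Ico_self, Finset.prod_empty, mul_one] at ht
    rw [show 2 * (n + 1) + 1 = 2 * n + 1 + 1 + 1 by ring, Finset.sum_range_succ,
      Finset.sum_range_succ, tri_odd, tri_even, mul_add, mul_add, Finset.sum_range_succ _ (n + 1),
      Finset.Ico_self, Finset.prod_empty, mul_one]
    congr 1
    rw [← ht, Finset.prod_range_succ, mul_right_comm, ih, Finset.sum_mul, ← Finset.sum_add_distrib]
    refine Finset.sum_congr rfl fun s hs ↦ ?_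
    rw [Finset.prod_Ico_succ_top (by simpa [Nat.lt_succ_iff] using hs)]
    ring

theorem tendsto_sum_pow_triangular :
    Tendsto (fun n ↦ ∑ s ∈ Finset.range (2 * n + 1), (X : (ZMod 2)⟦X⟧) ^ (s * (s + 1) / 2)) atTop
      (nhds (indicatorSeries fun n ↦ IsSquare (8 * n + 1))) := by
  rw [tendsto_iff_coeff_tendsto]
  refine fun d ↦ tendsto_atTop_of_eventually_const (i₀ := d) fun n hn ↦ ?_
  have two_mul_tri (s : ℕ) : 2 * (s * (s + 1) / 2) = s * (s + 1) :=
    Nat.mul_div_cancel' (Nat.even_mul_succ_self s).two_dvd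
  rw [indicatorSeries, coeff_mk, map_sum]
  simp_rw [coeff_X_pow]
  split_ifs with h
  · obtain ⟨m, hm⟩ := h
    obtain ⟨s, rfl⟩ : ∃ s, m = 2 * s + 1 := by
      have : Odd (m * m) := hm ▸ ⟨4 * d, by ring⟩
      exact (Nat.odd_mul.mp this).1
    have hs : d = s * (s + 1) / 2 := by
      have := two_mul_tri s
      nlinarith
    have hsd : s ≤ d := by
      have := two_mul_tri s
      nlinarith
    rw [Finset.sum_eq_single s, if_pos hs]
    · intro t _ hts
      refine if_neg fun ht ↦ hts ?_
      have h1 := two_mul_tri s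
      have h2 := two_mul_tri t
      rw [← hs] at h1
      rw [← ht] at h2
      rcases lt_trichotomy t s with h | h | h
      · nlinarith
      · exact h
      · nlinarith
    · intro h
      exact absurd (Finset.mem_range.mpr (by omega)) h
  · refine Finset.sum_eq_zero fun s _ ↦ if_neg fun hs ↦ h ⟨2 * s + 1, ?_⟩
    have := two_mul_tri s
    rw [← hs] at this
    linarith

theorem prod_range_two_mul {M : Type*} [CommMonoid M] (f : ℕ → M) (n : ℕ) :
    ∏ i ∈ Finset.range (2 * n), f i =
      (∏ i ∈ Finset.range n, f (2 * i)) * ∏ i ∈ Finset.range n, f (2 * i + 1) := by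
  induction n with
  | zero => simp
  | succ n ih =>
    rw [show 2 * (n + 1) = 2 * n + 1 + 1 by ring, Finset.prod_range_succ, Finset.prod_range_succ,
      ih, Finset.prod_range_succ, Finset.prod_range_succ, mul_mul_mul_comm, mul_assoc]

theorem constantCoeff_pentagonalSeries : constantCoeff (pentagonalSeries (ZMod 2)) = 1 := by
  rw [← coeff_zero_eq_constantCoeff_apply, pentagonalSeries_eq_indicatorSeries, indicatorSeries,
    coeff_mk, if_pos (by simp)]

theorem ne_zero_of_constantCoeff_eq_one {R : Type*} [CommSemiring R] [Nontrivial R] {f : R⟦X⟧}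
    (h : constantCoeff f = 1) : f ≠ 0 := by
  rintro rfl
  simp at h

theorem tendsto_prod_mul_sum_pow_triangular :
    Tendsto (fun n ↦ ∑ s ∈ Finset.range (n + 1),
      (∏ i ∈ Finset.range s, (1 - (X : (ZMod 2)⟦X⟧) ^ (2 * i + 1))) *
        (∏ i ∈ Finset.Ico s n, (1 - X ^ (2 * (i + 1)))) * X ^ (s * (2 * n + 1))) atTop
      (nhds (pentagonalSeries (ZMod 2) ^ 2)) := by
  have hE := ((hasProd_one_sub_X_pow (ZMod 2)).tendsto_prod_nat).pow 2
  rw [tendsto_iff_coeff_tendsto] at hE ⊢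
  refine fun d ↦ (hE d).congr' ?_
  filter_upwards [eventually_ge_atTop d] with n hn
  rw [Finset.sum_range_succ', map_add, map_sum, Finset.sum_eq_zero, zero_add]
  · simp only [Finset.range_zero, Finset.prod_empty, one_mul, zero_mul, pow_zero, mul_one,
      Nat.Ico_zero_eq_range, ← Finset.prod_pow]
    congr 1
    refine Finset.prod_congr rfl fun i _ ↦ ?_
    linear_combination (X ^ (2 * (i + 1)) - X ^ (i + 1)) * ZMod.powerSeries_two_eq_zero
  · intro s _
    refine X_pow_dvd_iff.mp (dvd_mul_left _ _) d ?_
    nlinarith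

/-- Gauss's identity for the triangular numbers, modulo `2`. -/
theorem indicatorSeries_triangular_eq_pow_three :
    (indicatorSeries fun n ↦ IsSquare (8 * n + 1)) = pentagonalSeries (ZMod 2) ^ 3 := by
  have hE := (hasProd_one_sub_X_pow (ZMod 2)).tendsto_prod_nat
  have hE2 : Tendsto (fun n : ℕ ↦ 2 * n) atTop atTop := tendsto_id.const_mul_atTop' two_pos
  have h1 := (hE.comp hE2).mul tendsto_sum_pow_triangular
  have h2 := (hE.pow 2).mul tendsto_prod_mul_sum_pow_triangular
  refine mul_left_cancel₀ (ne_zero_of_constantCoeff_eq_one constantCoeff_pentagonalSeries) ?_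
  rw [tendsto_nhds_unique h1 (h2.congr fun n ↦ ?_)]
  · ring
  · simp only [Function.comp_apply]
    rw [prod_range_two_mul, mul_right_comm, prod_mul_sum_pow_triangular, mul_comm,
      ← Finset.prod_pow]
    congr 1
    refine Finset.prod_congr rfl fun i _ ↦ ?_
    linear_combination (X ^ (2 * (i + 1)) - X ^ (i + 1)) * ZMod.powerSeries_two_eq_zero

/-- The 3-dissection of `∏ (1 - X ^ n) ^ 3` modulo `2`. -/
theorem pentagonalSeries_pow_three :
    pentagonalSeries (ZMod 2) ^ 3 = expand 3 three_ne_zero (pentagonalSeries (ZMod 2)) +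
      X * expand 3 three_ne_zero (expand 3 three_ne_zero (pentagonalSeries (ZMod 2))) ^ 3 := by
  rw [← expand_mul, ← map_pow, ← indicatorSeries_triangular_eq_pow_three,
    pentagonalSeries_eq_indicatorSeries]
  ext d
  rcases d with _ | d
  · simp [indicatorSeries]
  have mod_nine {m : ℕ} (hm : 8 * (d + 1) + 1 = m * m) :
      3 ∣ d + 1 ∧ ¬ 3 * 3 ∣ d ∧ ¬ 3 ∣ m ∨ ¬ 3 ∣ d + 1 ∧ 3 * 3 ∣ d ∧ 3 ∣ m := by
    have h9 : (8 * (d + 1) + 1) % 9 = (m % 9) * (m % 9) % 9 := by rw [hm, Nat.mul_mod]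
    have : m % 9 < 9 := Nat.mod_lt _ (by norm_num)
    interval_cases h : m % 9 <;> omega
  have h3 : 3 ∣ d + 1 → 24 * ((d + 1) / 3) + 1 = 8 * (d + 1) + 1 := by omega
  have h9 : 3 * 3 ∣ d → 8 * (d + 1) + 1 = 3 * 3 * (8 * (d / (3 * 3)) + 1) := by omega
  simp only [map_add, coeff_succ_X_mul, coeff_expand, indicatorSeries, coeff_mk]
  by_cases h : IsSquare (8 * (d + 1) + 1)
  · rw [if_pos h]
    obtain ⟨m, hm⟩ := h
    rcases mod_nine hm with ⟨hd, hd', -⟩ | ⟨hd, hd', t, rfl⟩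
    · rw [if_pos hd, if_neg hd', if_pos (h3 hd ▸ ⟨m, hm⟩), add_zero]
    · have ht : 8 * (d / (3 * 3)) + 1 = t * t := by
        have := h9 hd'
        nlinarith
      rw [if_neg hd, if_pos hd', if_pos ⟨t, ht⟩, zero_add]
  · rw [if_neg h, eq_comm, ite_eq_right_iff.mpr fun hd ↦ if_neg (h3 hd ▸ h),
      ite_eq_right_iff.mpr fun hd ↦ if_neg ?_, add_zero]
    rintro ⟨t, ht⟩
    exact h ⟨3 * t, by rw [h9 hd, ht]; ring⟩

/-- A cubic modular equation modulo `2` for the Euler product. -/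
theorem pentagonalSeries_modular_equation :
    pentagonalSeries (ZMod 2) ^ 12 +
        pentagonalSeries (ZMod 2) ^ 3 * expand 3 three_ne_zero (pentagonalSeries (ZMod 2)) ^ 3 +
        X * expand 3 three_ne_zero (pentagonalSeries (ZMod 2)) ^ 12 = 0 := by
  set E := pentagonalSeries (ZMod 2)
  set E₃ := expand 3 three_ne_zero E with hE₃
  set E₉ := expand 3 three_ne_zero E₃ with hE₉
  have hE : E ^ 3 = E₃ + X * E₉ ^ 3 := pentagonalSeries_pow_three
  set r := E ^ 12 + E ^ 3 * E₃ ^ 3 + X * E₃ ^ 12 with hr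
  have hr₃ : r = X * expand 3 three_ne_zero r := by
    simp only [hr, map_add, map_mul, map_pow, expand_X, ← hE₃, ← hE₉]
    rw [show E ^ 12 = (E ^ 3) ^ 4 by ring, hE]
    linear_combination (E₃ ^ 4 + 2 * E₃ ^ 3 * (X * E₉ ^ 3) + 3 * E₃ ^ 2 * (X * E₉ ^ 3) ^ 2 +
      2 * E₃ * (X * E₉ ^ 3) ^ 3) * ZMod.powerSeries_two_eq_zero
  ext d
  induction d using Nat.strong_induction_on with
  | _ d ih =>
    rw [hr₃]
    rcases d with _ | d
    · simp
    · rw [coeff_succ_X_mul, coeff_expand, map_zero]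
      split_ifs
      · exact ih _ (by omega)
      · rfl

/-- The squares of the positive integers prime to `3`, modulo `2`. -/
noncomputable def squareSeries : (ZMod 2)⟦X⟧ :=
  indicatorSeries fun n ↦ IsSquare n ∧ ¬ 3 ∣ n

theorem squareSeries_add_pow_four :
    squareSeries + squareSeries ^ 4 =
      X * expand 3 three_ne_zero (pentagonalSeries (ZMod 2)) ^ 8 := by
  rw [show squareSeries ^ 4 = (squareSeries ^ 2) ^ 2 by ring,
    show ∀ f : (ZMod 2)⟦X⟧, f ^ 8 = ((f ^ 2) ^ 2) ^ 2 by intro f; ring]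
  simp only [← ZMod.expand_two, ← expand_mul, pentagonalSeries_eq_indicatorSeries, squareSeries]
  ext d
  simp only [map_add, coeff_expand, indicatorSeries, coeff_mk]
  rcases d with _ | d
  · simp
  rw [coeff_succ_X_mul, coeff_expand, coeff_mk]
  have h24 : 2 * 2 * 2 * 3 ∣ d → 24 * (d / (2 * 2 * 2 * 3)) + 1 = d + 1 := by omega
  have h4 : 2 * 2 ∣ d + 1 → d + 1 = 2 * 2 * ((d + 1) / (2 * 2)) := by omega
  have h43 : 2 * 2 ∣ d + 1 → (3 ∣ (d + 1) / (2 * 2) ↔ 3 ∣ d + 1) := by omega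
  by_cases h : IsSquare (d + 1)
  · by_cases h3 : 3 ∣ d + 1
    · have : ¬ 2 * 2 * 2 * 3 ∣ d := by omega
      rw [if_neg (by tauto), if_neg this, zero_add, ite_eq_right_iff]
      exact fun hd ↦ if_neg (by tauto)
    · obtain ⟨m, hm⟩ := h
      have hmod : 2 ∣ m ∧ 2 * 2 ∣ d + 1 ∧ ¬ 2 * 2 * 2 * 3 ∣ d ∨
          ¬ 2 * 2 ∣ d + 1 ∧ 2 * 2 * 2 * 3 ∣ d := by
        have h24 : (d + 1) % 24 = (m % 24) * (m % 24) % 24 := by rw [hm, Nat.mul_mod]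
        have : m % 24 < 24 := Nat.mod_lt _ (by norm_num)
        interval_cases h : m % 24 <;> omega
      rw [if_pos ⟨⟨m, hm⟩, h3⟩]
      rcases hmod with ⟨⟨t, rfl⟩, hd, hd'⟩ | ⟨hd, hd'⟩
      · have ht : (d + 1) / (2 * 2) = t * t := by
          have := h4 hd
          nlinarith
        rw [if_neg hd', if_pos hd, if_pos ⟨⟨t, ht⟩, (h43 hd).not.mpr h3⟩]
        rfl
      · rw [if_neg hd, if_pos hd', if_pos (h24 hd' ▸ ⟨m, hm⟩), add_zero]
  · rw [if_neg (by tauto), zero_add, eq_comm, ite_eq_right_iff.mpr fun hd ↦ if_neg (h24 hd ▸ h),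
      eq_comm, ite_eq_right_iff]
    refine fun hd ↦ if_neg ?_
    rintro ⟨⟨t, ht⟩, -⟩
    exact h ⟨2 * t, by rw [h4 hd, ht]; ring⟩

theorem expand_three_mul_squareSeries :
    expand 3 three_ne_zero (pentagonalSeries (ZMod 2)) * squareSeries =
      X * expand 3 three_ne_zero (expand 3 three_ne_zero (pentagonalSeries (ZMod 2))) ^ 3 := by
  have hmod := congrArg (expand 3 three_ne_zero) pentagonalSeries_modular_equation
  have hsq := squareSeries_add_pow_four
  have hconst : constantCoeff (expand 3 three_ne_zero (pentagonalSeries (ZMod 2))) = 1 := by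
    rw [constantCoeff_expand, constantCoeff_pentagonalSeries]
  have hconstS : constantCoeff squareSeries = 0 := by
    rw [← coeff_zero_eq_constantCoeff_apply, squareSeries, indicatorSeries, coeff_mk,
      if_neg (by simp)]
  simp only [map_add, map_mul, map_pow, expand_X, map_zero] at hmod
  set E₃ := expand 3 three_ne_zero (pentagonalSeries (ZMod 2))
  set E₉ := expand 3 three_ne_zero E₃
  set w := E₃ * squareSeries + X * E₉ ^ 3 with hw
  have hw0 : w * (w ^ 3 + E₃ ^ 3) = 0 := by
    rw [hw]
    linear_combination E₃ ^ 4 * hsq + X * hmod + (2 * (E₃ * squareSeries) ^ 3 * (X * E₉ ^ 3) +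
      3 * (E₃ * squareSeries) ^ 2 * (X * E₉ ^ 3) ^ 2 +
      2 * (E₃ * squareSeries) * (X * E₉ ^ 3) ^ 3) * ZMod.powerSeries_two_eq_zero
  rcases mul_eq_zero.mp hw0 with h | h
  · linear_combination h - X * E₉ ^ 3 * ZMod.powerSeries_two_eq_zero
  · have := congrArg constantCoeff h
    simp [hw, hconst, hconstS] at this

/-- The key identity `∏ (1 - X ^ n) ^ 3 / (1 - X ^ (3 * n)) = 1 + ∑ X ^ (ℓ ^ 2)` modulo `2`, the
sum being over the positive integers `ℓ` prime to `3`. -/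
theorem expand_three_mul_one_add_squareSeries :
    expand 3 three_ne_zero (pentagonalSeries (ZMod 2)) * (1 + squareSeries) =
      pentagonalSeries (ZMod 2) ^ 3 := by
  rw [mul_add, mul_one, expand_three_mul_squareSeries, pentagonalSeries_pow_three]

/-- The generating function of `PD k` modulo `2`. -/
theorem coeff_genFun_eq_PD (k n : ℕ) :
    (Nat.Partition.genFun fun i c ↦ if k ∣ i then (0 : ZMod 2) else c).coeff n = PD k n := by
  simp only [Nat.Partition.coeff_genFun, PD, Nat.cast_sum, Nat.cast_ite, Nat.cast_prod,
    Nat.cast_zero]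
  refine Finset.sum_congr rfl fun p _ ↦ ?_
  simp only [Finsupp.prod, Multiset.toFinsupp_support, Multiset.toFinsupp_apply]
  split_ifs with h
  · exact Finset.prod_congr rfl fun s hs ↦ if_neg (h s (Multiset.mem_toFinset.mp hs))
  · push Not at h
    obtain ⟨s, hs, hks⟩ := h
    exact Finset.prod_eq_zero (Multiset.mem_toFinset.mpr hs) (if_pos hks)

theorem PowerSeries.continuous_expand {R : Type*} [CommRing R] [TopologicalSpace R] {k : ℕ}
    (hk : k ≠ 0) : Continuous (expand k hk : R⟦X⟧ →ₐ[R] R⟦X⟧) := by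
  refine continuous_iff_continuousAt.mpr fun f ↦ (tendsto_iff_coeff_tendsto ..).mpr fun d ↦ ?_
  simp only [coeff_expand]
  split_ifs
  · exact (continuous_coeff _ _).tendsto f
  · exact tendsto_const_nhds

/-- The Euler product in the variable `X ^ (k * m)`, with factors indexed by multiples of `k`. -/
theorem hasProd_expand_pentagonalSeries {k m : ℕ} (hk : k ≠ 0) (hm : m ≠ 0) :
    HasProd (fun i ↦ if k ∣ i + 1 then (1 - (X ^ (i + 1)) ^ m : (ZMod 2)⟦X⟧) else 1)
      (expand k hk (expand m hm (pentagonalSeries (ZMod 2)))) := by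
  have h := (hasProd_one_sub_X_pow (ZMod 2)).map (expand (k * m) (mul_ne_zero hk hm))
    (continuous_expand _)
  rw [expand_mul] at h
  have hinj : Function.Injective fun i : ℕ ↦ k * (i + 1) - 1 := by
    intro a b hab
    have ha : 0 < k * (a + 1) := by positivity
    have hb : 0 < k * (b + 1) := by positivity
    have : k * (a + 1) = k * (b + 1) := by simp only at hab; omega
    simpa [hk] using this
  rw [← hinj.hasProd_iff]
  · refine h.congr_fun fun i ↦ ?_
    have : k * (i + 1) - 1 + 1 = k * (i + 1) :=
      Nat.sub_add_cancel (Nat.mul_pos (Nat.pos_of_ne_zero hk) i.succ_pos)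
    simp only [Function.comp_apply, this, dvd_mul_right, if_true, map_sub, map_one, map_pow,
      expand_X]
    ring
  · intro i hi
    refine if_neg ?_
    rintro ⟨j, hj⟩
    rcases j with _ | j
    · simp at hj
    · exact hi ⟨j, by simp only; omega⟩

/-- Modulo `2`, `1 + ∑ j * X ^ (s * j) = (1 - X ^ (3 * s)) / (1 - X ^ s) ^ 3`. -/
theorem one_add_tsum_mul_one_sub_pow_three {s : ℕ} (hs : s ≠ 0) :
    (1 + ∑' j : ℕ, ((j + 1 : ℕ) : ZMod 2) • (X : (ZMod 2)⟦X⟧) ^ (s * (j + 1))) *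
      (1 - X ^ s) ^ 3 = 1 - (X ^ s) ^ 3 := by
  have hconst : constantCoeff ((X : (ZMod 2)⟦X⟧) ^ s) = 0 := by simp [hs]
  have hgeom := (summable_pow_of_constantCoeff_eq_zero hconst).mul_left (X ^ s)
  have hgeom_eq := tsum_pow_mul_one_sub_of_constantCoeff_eq_zero hconst
  have hsum : Summable fun j : ℕ ↦ ((j + 1 : ℕ) : ZMod 2) • (X : (ZMod 2)⟦X⟧) ^ (s * (j + 1)) :=
    Nat.Partition.summable_genFun_term' (fun _ c ↦ (c : ZMod 2)) hs
  have hrec : ∑' j : ℕ, ((j + 1 : ℕ) : ZMod 2) • (X : (ZMod 2)⟦X⟧) ^ (s * (j + 1)) =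
      X ^ s * ∑' j : ℕ, ((j + 1 : ℕ) : ZMod 2) • (X : (ZMod 2)⟦X⟧) ^ (s * (j + 1)) +
        X ^ s * ∑' j : ℕ, (X ^ s) ^ j := by
    have hshift := hsum.mul_left (X ^ s)
    rw [← hsum.tsum_mul_left,
      ← (summable_pow_of_constantCoeff_eq_zero hconst).tsum_mul_left, hgeom.tsum_eq_zero_add,
      hsum.tsum_eq_zero_add, add_left_comm,
      ← hshift.tsum_add ((summable_nat_add_iff 1).mpr hgeom)]
    congr 1
    · simp
    · refine tsum_congr fun j ↦ ?_
      simp only [smul_eq_C_mul, Nat.cast_add, Nat.cast_one, map_add, map_natCast, map_one, pow_mul]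
      ring
  linear_combination (1 - X ^ s) ^ 2 * hrec + (1 - X ^ s) * X ^ s * hgeom_eq +
    ((X ^ s) ^ 2 - X ^ s) * ZMod.powerSeries_two_eq_zero

/-- The product `∏ (1 - X ^ (3 * s)) / (1 - X ^ s) ^ 3` over the `s` not divisible by `k`. -/
theorem genFun_mul_pentagonalSeries_pow_three {k : ℕ} (hk : k ≠ 0) :
    (Nat.Partition.genFun fun i c ↦ if k ∣ i then (0 : ZMod 2) else c) *
        pentagonalSeries (ZMod 2) ^ 3 *
        expand k hk (expand 3 three_ne_zero (pentagonalSeries (ZMod 2))) =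
      expand 3 three_ne_zero (pentagonalSeries (ZMod 2)) *
        expand k hk (pentagonalSeries (ZMod 2)) ^ 3 := by
  have cube {f : ℕ → (ZMod 2)⟦X⟧} {a} (h : HasProd f a) : HasProd (fun i ↦ f i ^ 3) (a ^ 3) := by
    simpa only [pow_succ, pow_zero, one_mul] using (h.mul h).mul h
  have hG := Nat.Partition.hasProd_genFun fun i c ↦ if k ∣ i then (0 : ZMod 2) else c
  have hE := hasProd_one_sub_X_pow (ZMod 2)
  have hE₃ := hasProd_expand_pentagonalSeries one_ne_zero three_ne_zero
  have hEk := hasProd_expand_pentagonalSeries hk one_ne_zero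
  rw [expand_one_apply] at hE₃ hEk
  refine ((hG.mul (cube hE)).mul (hasProd_expand_pentagonalSeries hk three_ne_zero)).unique
    ((hE₃.mul (cube hEk)).congr_fun fun i ↦ ?_)
  simp only [one_dvd, if_true, pow_one]
  split_ifs with h
  · simp [mul_comm]
  · rw [mul_one, one_pow, mul_one, one_add_tsum_mul_one_sub_pow_three i.succ_ne_zero]

theorem genFun_mul_one_add_squareSeries {k : ℕ} (hk : k ≠ 0) :
    (Nat.Partition.genFun fun i c ↦ if k ∣ i then (0 : ZMod 2) else c) * (1 + squareSeries) =
      expand k hk (1 + squareSeries) := by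
  have key := expand_three_mul_one_add_squareSeries
  have key_k := congrArg (expand k hk) key
  rw [map_mul, map_pow] at key_k
  have hconst : constantCoeff (expand 3 three_ne_zero (pentagonalSeries (ZMod 2))) = 1 := by
    rw [constantCoeff_expand, constantCoeff_pentagonalSeries]
  refine mul_left_cancel₀ (mul_ne_zero (ne_zero_of_constantCoeff_eq_one hconst)
    (ne_zero_of_constantCoeff_eq_one ((constantCoeff_expand k hk _).trans hconst))) ?_
  linear_combination genFun_mul_pentagonalSeries_pow_three hk +
    (Nat.Partition.genFun fun i c ↦ if k ∣ i then (0 : ZMod 2) else c) *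
      expand k hk (expand 3 three_ne_zero (pentagonalSeries (ZMod 2))) * key -
    expand 3 three_ne_zero (pentagonalSeries (ZMod 2)) * key_k

theorem coeff_mul_squareSeries (f : (ZMod 2)⟦X⟧) (n : ℕ) :
    (f * squareSeries).coeff n =
      ∑ ℓ ∈ (Finset.range (n + 1)).filter (fun ℓ => 1 ≤ ℓ ∧ ¬ 3 ∣ ℓ ∧ ℓ ^ 2 ≤ n),
        f.coeff (n - ℓ ^ 2) := by
  rw [mul_comm, coeff_mul, Finset.Nat.sum_antidiagonal_eq_sum_range_succ_mk]
  simp only [squareSeries, indicatorSeries, coeff_mk, ite_mul, one_mul, zero_mul]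
  rw [← Finset.sum_filter]
  symm
  refine Finset.sum_bij (fun ℓ _ ↦ ℓ ^ 2) ?_ ?_ ?_ fun _ _ ↦ rfl
  · intro ℓ hℓ
    simp only [Finset.mem_filter, Finset.mem_range] at hℓ ⊢
    refine ⟨by omega, ⟨ℓ, sq ℓ⟩, fun h ↦ hℓ.2.2.1 (Nat.prime_three.dvd_of_dvd_pow h)⟩
  · intro a _ b _ hab
    exact Nat.pow_left_injective two_ne_zero hab
  · intro m hm
    simp only [Finset.mem_filter, Finset.mem_range] at hm
    obtain ⟨hmn, ⟨t, rfl⟩, h3⟩ := hm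
    have ht : t ≠ 0 := by
      rintro rfl
      simp at h3
    refine ⟨t, ?_, sq t⟩
    simp only [Finset.mem_filter, Finset.mem_range]
    refine ⟨by nlinarith [Nat.pos_of_ne_zero ht], Nat.pos_of_ne_zero ht,
      fun h ↦ h3 (h.mul_right t), by nlinarith⟩

theorem coeff_expand_one_add_squareSeries {k : ℕ} (hk : k ≠ 0) (n : ℕ) :
    (expand k hk (1 + squareSeries)).coeff n = 1 ↔
      (n = 0 ∨ ∃ m : ℕ, 1 ≤ m ∧ ¬ 3 ∣ m ∧ n = k * m ^ 2) := by
  rw [coeff_expand]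
  by_cases hkn : k ∣ n
  · obtain ⟨d, rfl⟩ := hkn
    rw [if_pos (dvd_mul_right k d), Nat.mul_div_cancel_left _ (Nat.pos_of_ne_zero hk), map_add,
      coeff_one, squareSeries, indicatorSeries, coeff_mk]
    simp only [mul_eq_zero, hk, false_or, mul_right_inj' hk]
    rcases eq_or_ne d 0 with rfl | hd
    · simp
    · rw [if_neg hd, zero_add, or_iff_right hd]
      trans IsSquare d ∧ ¬ 3 ∣ d
      · split_ifs with h <;> simp [h]
      constructor
      · rintro ⟨⟨t, rfl⟩, h3⟩
        refine ⟨t, Nat.pos_of_ne_zero ?_, fun h ↦ h3 (h.mul_right t), (sq t).symm⟩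
        rintro rfl
        exact hd rfl
      · rintro ⟨t, -, h3, rfl⟩
        exact ⟨⟨t, sq t⟩, fun h ↦ h3 (Nat.prime_three.dvd_of_dvd_pow h)⟩
  · rw [if_neg hkn]
    refine iff_of_false zero_ne_one ?_
    rintro (rfl | ⟨m, -, -, rfl⟩)
    · exact hkn (dvd_zero k)
    · exact hkn (dvd_mul_right k _)

theorem stmt_9 (n k : ℕ) (hk : 2 ≤ k) :
    Odd (PD k n +
        ∑ ℓ ∈ (Finset.range (n + 1)).filter (fun ℓ => 1 ≤ ℓ ∧ ¬ 3 ∣ ℓ ∧ ℓ ^ 2 ≤ n),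
          PD k (n - ℓ ^ 2)) ↔
      (n = 0 ∨ ∃ m : ℕ, 1 ≤ m ∧ ¬ 3 ∣ m ∧ n = k * m ^ 2) := by
  have hk0 : k ≠ 0 := by omega
  rw [← ZMod.natCast_eq_one_iff_odd, ← coeff_expand_one_add_squareSeries hk0,
    ← genFun_mul_one_add_squareSeries hk0, mul_add, mul_one, map_add, coeff_mul_squareSeries]
  simp only [coeff_genFun_eq_PD, Nat.cast_add, Nat.cast_sum]
end

section
/- For all integers n ≥ 1, PD_2(3n) ≡ 0 (mod 4); moreover, for all integers n ≥ 1 with 6 ∤ n, PD_2(2n + 1) ≡ 0 (mod 4). -/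
open PowerSeries Finset

section FiniteTripleProduct

variable {R : Type*} [CommRing R]

/-- The `q`-factorial `(q²; q²)ₙ`. -/
noncomputable def qFac (R : Type*) [CommRing R] (n : ℕ) : R⟦X⟧ :=
  ∏ i ∈ range n, (1 - X ^ (2 * (i + 1)))

/-- The reciprocal of the `q`-factorial `(q²; q²)ₙ`, extended by zero to negative `n`. -/
noncomputable def qFacInv (R : Type*) [CommRing R] (n : ℤ) : R⟦X⟧ :=
  if 0 ≤ n then invOfUnit (qFac R n.toNat) 1 else 0

lemma qFac_succ (n : ℕ) : qFac R (n + 1) = qFac R n * (1 - X ^ (2 * (n + 1))) :=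
  prod_range_succ _ _

lemma constantCoeff_qFac (n : ℕ) : constantCoeff (qFac R n) = 1 := by
  simp [qFac, map_prod]

lemma qFac_mul_qFacInv (n : ℕ) : qFac R n * qFacInv R n = 1 := by
  have := mul_invOfUnit (qFac R n) 1 (by simp [constantCoeff_qFac])
  simpa [qFacInv] using this

lemma qFacInv_of_neg {n : ℤ} (hn : n < 0) : qFacInv R n = 0 := if_neg (by omega)

lemma qFacInv_eq_mul_succ (n : ℕ) :
    qFacInv R n = (1 - X ^ (2 * (n + 1))) * qFacInv R ((n : ℤ) + 1) := by
  have h1 := qFac_mul_qFacInv (R := R) n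
  have h2 := qFac_mul_qFacInv (R := R) (n + 1)
  rw [qFac_succ] at h2
  push_cast at h2
  linear_combination (-qFacInv R n) * h2
    + ((1 - X ^ (2 * (n + 1))) * qFacInv R ((n : ℤ) + 1)) * h1

lemma qFacInv_sub_one (n : ℕ) :
    qFacInv R ((n : ℤ) - 1) = (1 - X ^ (2 * n)) * qFacInv R n := by
  cases n with
  | zero => simp [qFacInv]
  | succ n => simpa using qFacInv_eq_mul_succ (R := R) n

/-- The coefficient of `z ^ k` in `∏_{i < N} (1 + z q^(2i+1)) (1 + z⁻¹ q^(2i+1))`. -/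
noncomputable def tripleCoeff (R : Type*) [CommRing R] (N : ℕ) (k : ℤ) : R⟦X⟧ :=
  X ^ (k ^ 2).toNat * qFac R (2 * N) * qFacInv R (N - k) * qFacInv R (N + k)

lemma tripleCoeff_eq_zero {N : ℕ} {k : ℤ} (h : (N : ℤ) < |k|) : tripleCoeff R N k = 0 := by
  rcases lt_abs.1 h with h | h
  · simp [tripleCoeff, qFacInv_of_neg (show (N : ℤ) - k < 0 by omega)]
  · simp [tripleCoeff, qFacInv_of_neg (show (N : ℤ) + k < 0 by omega)]

lemma tripleCoeff_succ (N : ℕ) (k : ℤ) :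
    tripleCoeff R (N + 1) k = (1 + X ^ (4 * N + 2)) * tripleCoeff R N k
      + X ^ (2 * N + 1) * (tripleCoeff R N (k - 1) + tripleCoeff R N (k + 1)) := by
  by_cases h : ((N + 1 : ℕ) : ℤ) < |k|
  · rw [tripleCoeff_eq_zero h, tripleCoeff_eq_zero (N := N) (k := k),
      tripleCoeff_eq_zero (N := N) (k := k - 1), tripleCoeff_eq_zero (N := N) (k := k + 1)]
    · simp
    all_goals grind
  obtain ⟨a, ha⟩ : ∃ a : ℕ, (a : ℤ) = N + 1 - k := ⟨(N + 1 - k).toNat, by grind⟩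
  obtain ⟨b, hb⟩ : ∃ b : ℕ, (b : ℤ) = N + 1 + k := ⟨(N + 1 + k).toNat, by grind⟩
  have hab : a + b = 2 * N + 2 := by omega
  have hq : qFac R (2 * (N + 1))
      = qFac R (2 * N) * (1 - X ^ (2 * (2 * N + 1))) * (1 - X ^ (2 * (2 * N + 2))) := by
    rw [show 2 * (N + 1) = 2 * N + 1 + 1 by ring, qFac_succ, qFac_succ]
  have hA := qFacInv_sub_one (R := R) a
  have hB := qFacInv_sub_one (R := R) b
  have e1 : (X : R⟦X⟧) ^ (2 * N + 1) * X ^ ((k - 1) ^ 2).toNat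
      = X ^ (k ^ 2).toNat * X ^ (2 * a) := by
    rw [← pow_add, ← pow_add]
    congr 1
    zify
    rw [Int.toNat_of_nonneg (sq_nonneg _), Int.toNat_of_nonneg (sq_nonneg _), ha]
    ring
  have e2 : (X : R⟦X⟧) ^ (2 * N + 1) * X ^ ((k + 1) ^ 2).toNat
      = X ^ (k ^ 2).toNat * X ^ (2 * b) := by
    rw [← pow_add, ← pow_add]
    congr 1
    zify
    rw [Int.toNat_of_nonneg (sq_nonneg _), Int.toNat_of_nonneg (sq_nonneg _), hb]
    ring
  have e3 : (X : R⟦X⟧) ^ (2 * (2 * N + 2)) = X ^ (2 * a) * X ^ (2 * b) := by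
    rw [← pow_add]; congr 1; omega
  have e4 : (X : R⟦X⟧) ^ (2 * (2 * N + 2)) = X ^ (4 * N + 2) * X ^ 2 := by
    rw [← pow_add]; congr 1; omega
  have e5 : (X : R⟦X⟧) ^ (2 * (2 * N + 1)) = X ^ (4 * N + 2) := by
    congr 1; omega
  have hA2 : X ^ (2 * b) * qFacInv R ((a : ℤ) - 2)
      = (X ^ (2 * b) - X ^ (4 * N + 2)) * ((1 - X ^ (2 * a)) * qFacInv R a) := by
    rcases a with _ | a
    · simp [qFacInv_of_neg]
    · have := qFacInv_sub_one (R := R) a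
      rw [← hA, show ((a + 1 : ℕ) : ℤ) - 2 = (a : ℤ) - 1 by push_cast; ring, this,
        show ((a + 1 : ℕ) : ℤ) - 1 = a by push_cast; ring,
        show 4 * N + 2 = 2 * b + 2 * a by omega, pow_add]
      ring
  have hB2 : X ^ (2 * a) * qFacInv R ((b : ℤ) - 2)
      = (X ^ (2 * a) - X ^ (4 * N + 2)) * ((1 - X ^ (2 * b)) * qFacInv R b) := by
    rcases b with _ | b
    · simp [qFacInv_of_neg]
    · have := qFacInv_sub_one (R := R) b
      rw [← hB, show ((b + 1 : ℕ) : ℤ) - 2 = (b : ℤ) - 1 by push_cast; ring, this,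
        show ((b + 1 : ℕ) : ℤ) - 1 = b by push_cast; ring,
        show 4 * N + 2 = 2 * a + 2 * b by omega, pow_add]
      ring
  simp only [tripleCoeff]
  rw [show ((N + 1 : ℕ) : ℤ) - k = a by push_cast; omega,
    show ((N + 1 : ℕ) : ℤ) + k = b by push_cast; omega,
    show (N : ℤ) - k = a - 1 by omega, show (N : ℤ) + k = b - 1 by omega,
    show (N : ℤ) - (k - 1) = a by omega, show (N : ℤ) + (k - 1) = b - 2 by omega,
    show (N : ℤ) - (k + 1) = a - 2 by omega, show (N : ℤ) + (k + 1) = b by omega, hA, hB, hq]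
  set x : R⟦X⟧ := X ^ (2 * a)
  set y : R⟦X⟧ := X ^ (2 * b)
  set K : R⟦X⟧ := X ^ (k ^ 2).toNat
  set w : R⟦X⟧ := X ^ (4 * N + 2)
  rw [e5, e3]
  set D := qFac R (2 * N)
  set u := qFacInv R a
  set v := qFacInv R b
  linear_combination (-D * u * qFacInv R ((b : ℤ) - 2)) * e1 - (D * v * qFacInv R ((a : ℤ) - 2)) * e2
    - K * D * u * hB2 - K * D * v * hA2

/-- Finite form of the Jacobi triple product, with `z + z⁻¹` specialized to `t`. -/
theorem sum_tripleCoeff (t : R⟦X⟧) (c : ℤ → R⟦X⟧) (hc : ∀ k, c (k + 1) + c (k - 1) = t * c k)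
    (N : ℕ) : ∑ k ∈ Icc (-N : ℤ) N, c k * tripleCoeff R N k
      = c 0 * ∏ i ∈ range N, (1 + t * X ^ (2 * i + 1) + X ^ (4 * i + 2)) := by
  induction N with
  | zero =>
    have := qFac_mul_qFacInv (R := R) 0
    simp [qFac] at this
    simp [tripleCoeff, qFac, this]
  | succ N ih =>
    have extend (g : ℤ → R⟦X⟧) (j : ℤ) (hj : |j| ≤ 1) :
        ∑ k ∈ Icc (-(N + 1 : ℕ) : ℤ) (N + 1 : ℕ), g k * tripleCoeff R N (k + j)
          = ∑ k ∈ Icc (-N : ℤ) N, g (k - j) * tripleCoeff R N k := by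
      symm
      refine sum_of_injOn (fun k ↦ k - j) (by simp [Set.InjOn]) ?_ ?_ ?_
      · intro k hk
        simp only [coe_Icc, Set.mem_Icc] at *
        grind
      · intro k _ hk
        rw [tripleCoeff_eq_zero, mul_zero]
        contrapose! hk
        exact ⟨k + j, by simpa [← abs_le] using hk, by simp⟩
      · simp
    have h0 := extend c 0 (by simp)
    have h1 := extend c (-1) (by simp)
    have h2 := extend c 1 (by simp)
    have hsum : ∑ k ∈ Icc (-N : ℤ) N, c (k + 1) * tripleCoeff R N k
        + ∑ k ∈ Icc (-N : ℤ) N, c (k - 1) * tripleCoeff R N k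
        = t * ∑ k ∈ Icc (-N : ℤ) N, c k * tripleCoeff R N k := by
      rw [← sum_add_distrib, mul_sum]
      exact sum_congr rfl fun k _ ↦ by rw [← add_mul, hc, mul_assoc]
    simp only [add_zero, sub_zero, sub_neg_eq_add, ← sub_eq_add_neg] at h0 h1 h2
    rw [prod_range_succ, ← mul_assoc, ← ih]
    simp_rw [tripleCoeff_succ, mul_add, sum_add_distrib, mul_left_comm (c _), ← mul_sum]
    rw [h0, h1, h2]
    linear_combination X ^ (2 * N + 1) * hsum

lemma dvd_qFac_sub_qFac {m n : ℕ} (h : m ≤ n) :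
    (X : R⟦X⟧) ^ (2 * m + 2) ∣ qFac R n - qFac R m := by
  induction n, h using Nat.le_induction with
  | base => simp
  | succ n hn ih =>
    rw [qFac_succ, show qFac R n * (1 - X ^ (2 * (n + 1))) - qFac R m
      = (qFac R n - qFac R m) - qFac R n * X ^ (2 * (n + 1)) by ring]
    exact ih.sub (Dvd.dvd.mul_left (pow_dvd_pow _ (by omega)) _)

lemma dvd_qFac_mul_tripleCoeff_sub {N : ℕ} {k : ℤ} (hk : |k| ≤ N) :
    (X : R⟦X⟧) ^ (2 * N + 1) ∣ qFac R N * tripleCoeff R N k - X ^ (k ^ 2).toNat := by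
  obtain ⟨hk1, hk2⟩ := abs_le.1 hk
  obtain ⟨a, ha⟩ : ∃ a : ℕ, (a : ℤ) = N - k := ⟨(N - k).toNat, by omega⟩
  obtain ⟨b, hb⟩ : ∃ b : ℕ, (b : ℤ) = N + k := ⟨(N + k).toNat, by omega⟩
  have hA := qFac_mul_qFacInv (R := R) a
  have hB := qFac_mul_qFacInv (R := R) b
  rw [tripleCoeff, ← ha, ← hb]
  set m := min a b
  have d1 := dvd_qFac_sub_qFac (R := R) (show m ≤ N by omega)
  have d2 := dvd_qFac_sub_qFac (R := R) (show m ≤ 2 * N by omega)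
  have d3 := dvd_qFac_sub_qFac (R := R) (show m ≤ a by omega)
  have d4 := dvd_qFac_sub_qFac (R := R) (show m ≤ b by omega)
  have key : (X : R⟦X⟧) ^ (2 * m + 2) ∣ qFac R N * qFac R (2 * N) - qFac R a * qFac R b := by
    rw [show qFac R N * qFac R (2 * N) - qFac R a * qFac R b
      = (qFac R N - qFac R m) * qFac R (2 * N) + qFac R m * (qFac R (2 * N) - qFac R m)
        - ((qFac R a - qFac R m) * qFac R b + qFac R m * (qFac R b - qFac R m)) by ring]
    exact ((d1.mul_right _).add (d2.mul_left _)).sub ((d3.mul_right _).add (d4.mul_left _))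
  rw [show qFac R N * (X ^ (k ^ 2).toNat * qFac R (2 * N) * qFacInv R a * qFacInv R b)
      - X ^ (k ^ 2).toNat
    = X ^ (k ^ 2).toNat * (qFac R N * qFac R (2 * N) - qFac R a * qFac R b)
      * (qFacInv R a * qFacInv R b) by
    linear_combination X ^ (k ^ 2).toNat * (qFac R b * qFacInv R b) * hA
      + X ^ (k ^ 2).toNat * hB]
  refine Dvd.dvd.mul_right (dvd_trans ?_ (mul_dvd_mul_left _ key)) _
  rw [← pow_add]
  refine pow_dvd_pow _ ?_
  zify
  rw [Int.toNat_of_nonneg (sq_nonneg _)]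
  rcases le_total a b with h | h
  · rw [show (m : ℤ) = N - k by omega]
    nlinarith [sq_nonneg (k - 1)]
  · rw [show (m : ℤ) = N + k by omega]
    nlinarith [sq_nonneg (k + 1)]

/-- The Jacobi triple product modulo `q ^ (2N+1)`, with `z + z⁻¹` specialized to `t`. -/
theorem dvd_tripleProduct_sub (t : R⟦X⟧) (c : ℤ → R⟦X⟧)
    (hc : ∀ k, c (k + 1) + c (k - 1) = t * c k) (hc0 : c 0 = 1) (N : ℕ) :
    (X : R⟦X⟧) ^ (2 * N + 1) ∣
      qFac R N * ∏ i ∈ range N, (1 + t * X ^ (2 * i + 1) + X ^ (4 * i + 2))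
        - (1 + ∑ k ∈ Icc 1 N, (c k + c (-k)) * X ^ (k ^ 2)) := by
  have hsplit (M : ℕ) : ∑ k ∈ Icc (-M : ℤ) M, c k * (X : R⟦X⟧) ^ (k ^ 2).toNat
      = 1 + ∑ k ∈ Icc 1 M, (c k + c (-k)) * X ^ (k ^ 2) := by
    induction M with
    | zero => simp [hc0]
    | succ M ih =>
      have : Icc (-(M + 1 : ℕ) : ℤ) (M + 1 : ℕ)
          = insert (-(M + 1 : ℕ) : ℤ) (insert ((M + 1 : ℕ) : ℤ) (Icc (-M : ℤ) M)) := by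
        ext; simp; omega
      rw [this, sum_insert (by simp; omega), sum_insert (by simp), ih,
        sum_Icc_succ_top (by omega), neg_sq,
        show (((M + 1 : ℕ) : ℤ) ^ 2).toNat = (M + 1) ^ 2 by
          rw [← Nat.cast_pow, Int.toNat_natCast]]
      ring
  have h := sum_tripleCoeff t c hc N
  rw [hc0, one_mul] at h
  rw [← h, ← hsplit, mul_sum, ← sum_sub_distrib]
  refine dvd_sum fun k hk ↦ ?_
  rw [mul_left_comm, ← mul_sub]
  exact (dvd_qFac_mul_tripleCoeff_sub (abs_le.2 (mem_Icc.1 hk))).mul_left _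

end FiniteTripleProduct

section GeneratingFunction

open scoped PowerSeries.WithPiTopology

lemma dvd_prod_sub_one {ι A : Type*} [CommRing A] (x : A) (g : ι → A) (s : Finset ι)
    (h : ∀ i ∈ s, x ∣ g i - 1) : x ∣ ∏ i ∈ s, g i - 1 := by
  classical
  induction s using Finset.induction_on with
  | empty => simp
  | insert a s ha ih =>
    rw [prod_insert ha,
      show g a * ∏ i ∈ s, g i - 1 = (g a - 1) * ∏ i ∈ s, g i + (∏ i ∈ s, g i - 1) by ring]
    exact ((h a (mem_insert_self _ _)).mul_right _).add
      (ih fun i hi ↦ h i (mem_insert_of_mem hi))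

variable {R : Type*} [CommRing R] [TopologicalSpace R]

/-- The factor belonging to the part size `s` in the generating function of a character. -/
noncomputable def genFactor (f : ℕ → ℕ → R) (s : ℕ) : R⟦X⟧ :=
  1 + ∑' j, f s (j + 1) • X ^ (s * (j + 1))

lemma dvd_genFactor_sub_one [T2Space R] (f : ℕ → ℕ → R) {s : ℕ} (hs : s ≠ 0) :
    (X : R⟦X⟧) ^ s ∣ genFactor f s - 1 := by
  rw [genFactor, add_sub_cancel_left, X_pow_dvd_iff]
  intro m hm
  rw [(Nat.Partition.summable_genFun_term' f hs).map_tsum _ (WithPiTopology.continuous_coeff _ _)]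
  refine (tsum_congr fun j ↦ ?_).trans tsum_zero
  rw [map_smul, coeff_X_pow, if_neg (by nlinarith), smul_zero]

lemma dvd_genFun_sub_prod [T2Space R] (f : ℕ → ℕ → R) (M : ℕ) :
    (X : R⟦X⟧) ^ (M + 1) ∣
      Nat.Partition.genFun f - ∏ i ∈ range M, genFactor f (i + 1) := by
  rw [X_pow_dvd_iff]
  intro d hd
  have h := (WithPiTopology.tendsto_iff_coeff_tendsto R _ _ _).1 (Nat.Partition.hasProd_genFun f) d
  rw [map_sub, sub_eq_zero]
  refine tendsto_nhds_unique h (tendsto_atTop_of_eventually_const (i₀ := range M) fun s hs ↦ ?_)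
  change coeff d (∏ i ∈ s, genFactor f (i + 1)) = _
  rw [← prod_sdiff hs, ← sub_eq_zero, ← map_sub, ← sub_one_mul]
  refine X_pow_dvd_iff.1 (Dvd.dvd.mul_right (dvd_prod_sub_one _ _ _ fun i hi ↦ ?_) _) d hd
  refine dvd_trans (pow_dvd_pow _ ?_) (dvd_genFactor_sub_one f (Nat.succ_ne_zero i))
  simp at hi
  omega

/-- The character of partitions with designated summands and odd parts. -/
def oddDesignated (R : Type*) [CommRing R] (s c : ℕ) : R := if 2 ∣ s then 0 else c

lemma coeff_genFun_oddDesignated (R : Type*) [CommRing R] (n : ℕ) :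
    coeff n (Nat.Partition.genFun (oddDesignated R)) = (PD 2 n : R) := by
  rw [Nat.Partition.coeff_genFun, PD, Nat.cast_sum]
  refine sum_congr rfl fun p _ ↦ ?_
  simp only [Finsupp.prod, Multiset.toFinsupp_support, Multiset.toFinsupp_apply]
  split_ifs with h
  · rw [Nat.cast_prod]
    exact prod_congr rfl fun s hs ↦ if_neg (h s (Multiset.mem_toFinset.1 hs))
  · push Not at h
    obtain ⟨s, hs, h2⟩ := h
    rw [Nat.cast_zero]
    exact prod_eq_zero (Multiset.mem_toFinset.2 hs) (if_pos h2)

lemma genFactor_oddDesignated_even (i : ℕ) : genFactor (oddDesignated R) (2 * i) = 1 := by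
  simp [genFactor, oddDesignated]

lemma genFactor_oddDesignated_odd [T2Space R] [IsTopologicalRing R] (i : ℕ) :
    genFactor (oddDesignated R) (2 * i + 1) * (1 - X ^ (2 * i + 1)) ^ 2
      = 1 - X ^ (2 * i + 1) + X ^ (4 * i + 2) := by
  set q : R⟦X⟧ := X ^ (2 * i + 1) with hq
  have hq2 : (X : R⟦X⟧) ^ (4 * i + 2) = q ^ 2 := by rw [hq, ← pow_mul]; congr 1; ring
  have hq0 : constantCoeff q = 0 := by simp [hq]
  have hterm (j : ℕ) : oddDesignated R (2 * i + 1) (j + 1) • (X : R⟦X⟧) ^ ((2 * i + 1) * (j + 1))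
      = ((j + 1 : ℕ) : R⟦X⟧) * q ^ (j + 1) := by
    rw [oddDesignated, if_neg (by omega), pow_mul, ← hq, ← nsmul_eq_mul, Nat.cast_smul_eq_nsmul]
  have hs : Summable fun j : ℕ ↦ ((j + 1 : ℕ) : R⟦X⟧) * q ^ (j + 1) := by
    simp_rw [← hterm]
    exact Nat.Partition.summable_genFun_term' _ (by omega)
  have hg : Summable fun j : ℕ ↦ q ^ j := WithPiTopology.summable_pow_of_constantCoeff_eq_zero hq0
  have hgeom := WithPiTopology.tsum_pow_mul_one_sub_of_constantCoeff_eq_zero hq0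
  have hs' : Summable fun j : ℕ ↦ (j : R⟦X⟧) * q ^ j :=
    (summable_nat_add_iff (f := fun j : ℕ ↦ (j : R⟦X⟧) * q ^ j) 1).1 hs
  have h1 : ∑' j : ℕ, ((j + 1 : ℕ) : R⟦X⟧) * q ^ (j + 1) = ∑' j : ℕ, (j : R⟦X⟧) * q ^ j := by
    rw [hs'.tsum_eq_zero_add]; simp
  have h2 : ∑' j : ℕ, ((j + 1 : ℕ) : R⟦X⟧) * q ^ (j + 1)
      = q * ∑' j : ℕ, (j : R⟦X⟧) * q ^ j + q * ∑' j : ℕ, q ^ j := by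
    rw [← hs'.tsum_mul_left, ← hg.tsum_mul_left,
      ← (hs'.mul_left q).tsum_add (hg.mul_left q)]
    exact tsum_congr fun j ↦ by push_cast; ring
  rw [genFactor, tsum_congr hterm, hq2]
  rw [← h1] at h2
  linear_combination (1 - q) * h2 + q * hgeom

lemma dvd_genFun_oddDesignated_mul_sub [T2Space R] [IsTopologicalRing R] (N : ℕ) :
    (X : R⟦X⟧) ^ (2 * N + 1) ∣ Nat.Partition.genFun (oddDesignated R)
        * ∏ i ∈ range N, (1 + (-2) * X ^ (2 * i + 1) + X ^ (4 * i + 2))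
      - ∏ i ∈ range N, (1 + (-1) * X ^ (2 * i + 1) + X ^ (4 * i + 2)) := by
  have hprod : (∏ i ∈ range (2 * N), genFactor (oddDesignated R) (i + 1))
      * ∏ i ∈ range N, (1 + (-2) * X ^ (2 * i + 1) + X ^ (4 * i + 2))
      = ∏ i ∈ range N, (1 + (-1) * X ^ (2 * i + 1) + X ^ (4 * i + 2)) := by
    induction N with
    | zero => simp
    | succ N ih =>
      have h := genFactor_oddDesignated_odd (R := R) N
      rw [show 2 * (N + 1) = 2 * N + 1 + 1 by ring, prod_range_succ, prod_range_succ,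
        prod_range_succ _ N, prod_range_succ _ N, ← ih,
        show 2 * N + 1 + 1 = 2 * (N + 1) by ring, genFactor_oddDesignated_even]
      have hX : (X : R⟦X⟧) ^ (4 * N + 2) = (X ^ (2 * N + 1)) ^ 2 := by
        rw [← pow_mul]; congr 1; ring
      rw [hX] at h ⊢
      linear_combination ((∏ i ∈ range (2 * N), genFactor (oddDesignated R) (i + 1))
        * ∏ i ∈ range N, (1 + (-2) * X ^ (2 * i + 1) + X ^ (4 * i + 2))) * h
  rw [← hprod, ← sub_mul]
  exact (dvd_genFun_sub_prod _ _).mul_right _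

end GeneratingFunction

/-- Twice the real part of `ω ^ k`, for `ω` a primitive cube root of unity, modulo `4`. -/
def cubicTrace (k : ℕ) : ZMod 4 := if 3 ∣ k then 2 else -1

lemma four_eq_zero_zmod_four_powerSeries : (4 : (ZMod 4)⟦X⟧) = 0 := by
  rw [← map_ofNat (C (R := ZMod 4)) 4, show (OfNat.ofNat 4 : ZMod 4) = 0 from rfl, map_zero]

lemma dvd_genFun_mul_theta_sub_theta (N : ℕ) :
    (X : (ZMod 4)⟦X⟧) ^ (2 * N + 1) ∣ Nat.Partition.genFun (oddDesignated (ZMod 4))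
        * (1 + 2 * ∑ k ∈ Icc 1 N, X ^ (k ^ 2))
      - (1 + ∑ k ∈ Icc 1 N, C (cubicTrace k) * X ^ (k ^ 2)) := by
  have hφ := dvd_tripleProduct_sub (R := ZMod 4) (-2) (fun k ↦ if Even k then 1 else -1)
    (fun k ↦ by
      simp only [Int.even_add_one, Int.even_sub_one]
      split_ifs <;> ring) (by simp) N
  have hθ := dvd_tripleProduct_sub (R := ZMod 4) (-1)
    (fun k ↦ if k % 3 = 0 then 1 else if k % 3 = 1 then 0 else -1)
    (fun k ↦ by
      have : k % 3 = 0 ∨ k % 3 = 1 ∨ k % 3 = 2 := by omega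
      rcases this with h | h | h
      · simp [h, show (k + 1) % 3 = 1 by omega, show (k - 1) % 3 = 2 by omega]
      · simp [h, show (k + 1) % 3 = 2 by omega, show (k - 1) % 3 = 0 by omega]
      · simp [h, show (k + 1) % 3 = 0 by omega, show (k - 1) % 3 = 1 by omega]) (by simp) N
  have hφ' : ∑ k ∈ Icc 1 N, ((if Even (k : ℤ) then (1 : (ZMod 4)⟦X⟧) else -1)
      + if Even (-(k : ℤ)) then 1 else -1) * X ^ (k ^ 2)
      = 2 * ∑ k ∈ Icc 1 N, X ^ (k ^ 2) := by
    rw [mul_sum]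
    refine sum_congr rfl fun k _ ↦ ?_
    simp only [even_neg]
    split_ifs
    · ring
    · linear_combination -X ^ (k ^ 2) * four_eq_zero_zmod_four_powerSeries
  have hθ' : ∑ k ∈ Icc 1 N,
      ((if (k : ℤ) % 3 = 0 then (1 : (ZMod 4)⟦X⟧) else if (k : ℤ) % 3 = 1 then 0 else -1)
      + if -(k : ℤ) % 3 = 0 then 1 else if -(k : ℤ) % 3 = 1 then 0 else -1) * X ^ (k ^ 2)
      = ∑ k ∈ Icc 1 N, C (cubicTrace k) * X ^ (k ^ 2) := by
    refine sum_congr rfl fun k _ ↦ ?_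
    congr 1
    have : k % 3 = 0 ∨ k % 3 = 1 ∨ k % 3 = 2 := by omega
    rcases this with h | h | h
    · rw [cubicTrace, if_pos (by omega), if_pos (by omega), if_pos (by omega), map_ofNat]
      norm_num
    · rw [cubicTrace, if_neg (by omega), if_pos (by omega), if_neg (by omega), if_neg (by omega),
        if_neg (by omega)]
      simp
    · rw [cubicTrace, if_neg (by omega), if_neg (by omega), if_neg (by omega), if_pos (by omega),
        if_neg (by omega)]
      simp
  rw [hφ'] at hφ
  rw [hθ'] at hθ
  have hF := dvd_genFun_oddDesignated_mul_sub (R := ZMod 4) N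
  have := ((hF.mul_left (qFac (ZMod 4) N)).sub
    (hφ.mul_left (Nat.Partition.genFun (oddDesignated (ZMod 4))))).add hθ
  convert! this using 1
  ring

lemma PD_two_cast_eq {n : ℕ} (hn : n ≠ 0) : (PD 2 n : ZMod 4)
    = (∑ k ∈ Icc 1 n, if n = k ^ 2 then cubicTrace k + 2 else 0)
      + ∑ p ∈ Icc 1 n ×ˢ Icc 1 n, if n = p.1 ^ 2 + p.2 ^ 2 then 2 * cubicTrace p.1 else 0 := by
  have h := (dvd_genFun_mul_theta_sub_theta n).mul_right
    (1 + 2 * ∑ k ∈ Icc 1 n, (X : (ZMod 4)⟦X⟧) ^ (k ^ 2))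
  set S := ∑ k ∈ Icc 1 n, (X : (ZMod 4)⟦X⟧) ^ (k ^ 2) with hS
  set T := ∑ k ∈ Icc 1 n, C (cubicTrace k) * (X : (ZMod 4)⟦X⟧) ^ (k ^ 2) with hT
  have e : (Nat.Partition.genFun (oddDesignated (ZMod 4)) * (1 + 2 * S) - (1 + T)) * (1 + 2 * S)
      = Nat.Partition.genFun (oddDesignated (ZMod 4)) - (1 + (T + 2 * S) + 2 * (T * S)) := by
    linear_combination (Nat.Partition.genFun (oddDesignated (ZMod 4)) * (S + S ^ 2))
      * four_eq_zero_zmod_four_powerSeries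
  rw [e, X_pow_dvd_iff] at h
  have h := h n (by omega)
  rw [map_sub, sub_eq_zero, coeff_genFun_oddDesignated] at h
  have hTS : T + 2 * S = ∑ k ∈ Icc 1 n, C (cubicTrace k + 2) * (X : (ZMod 4)⟦X⟧) ^ (k ^ 2) := by
    rw [hT, hS, mul_sum, ← sum_add_distrib]
    refine sum_congr rfl fun k _ ↦ ?_
    rw [map_add, map_ofNat]
    ring
  have hmul : 2 * (T * S) = ∑ p ∈ Icc 1 n ×ˢ Icc 1 n,
      C (2 * cubicTrace p.1) * (X : (ZMod 4)⟦X⟧) ^ (p.1 ^ 2 + p.2 ^ 2) := by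
    rw [hT, hS, sum_mul_sum, ← sum_product', mul_sum]
    refine sum_congr rfl fun k _ ↦ ?_
    rw [map_mul, map_ofNat]
    ring
  rw [h, hTS, hmul, map_add, map_add, map_sum, map_sum, coeff_one, if_neg hn, zero_add]
  simp only [coeff_C_mul_X_pow]

lemma cubicTrace_of_dvd {k : ℕ} (h : 3 ∣ k) : cubicTrace k = 2 := if_pos h

lemma cubicTrace_of_not_dvd {k : ℕ} (h : ¬ 3 ∣ k) : cubicTrace k = -1 := if_neg h

lemma three_dvd_of_three_dvd_sq_add_sq {a b : ℕ} (h : 3 ∣ a ^ 2 + b ^ 2) : 3 ∣ a ∧ 3 ∣ b := by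
  have ha : a % 3 = 0 ∨ a % 3 = 1 ∨ a % 3 = 2 := by omega
  have hb : b % 3 = 0 ∨ b % 3 = 1 ∨ b % 3 = 2 := by omega
  simp only [Nat.dvd_iff_mod_eq_zero] at *
  rcases ha with ha | ha | ha <;> rcases hb with hb | hb | hb <;>
    simp [Nat.add_mod, Nat.pow_mod, ha, hb] at h ⊢

lemma sq_mod_twelve (a : ℕ) :
    a ^ 2 % 12 = 0 ∧ 3 ∣ a ∨ a ^ 2 % 12 = 9 ∧ 3 ∣ a ∨ a ^ 2 % 12 = 1 ∧ ¬ 3 ∣ a ∨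
      a ^ 2 % 12 = 4 ∧ ¬ 3 ∣ a := by
  have h : a % 12 < 12 := Nat.mod_lt _ (by norm_num)
  have h3 : 3 ∣ a % 12 ↔ 3 ∣ a := Nat.dvd_mod_iff (by norm_num)
  rw [Nat.pow_mod, ← h3]
  clear h3
  generalize a % 12 = r at h
  interval_cases r <;> decide

lemma PD_two_mod_four {n : ℕ} (hn : n ≠ 0)
    (h : 3 ∣ n ∨ n % 12 = 5 ∨ n % 12 = 7 ∨ n % 12 = 11) : PD 2 n % 4 = 0 := by
  rw [← Nat.dvd_iff_mod_eq_zero, ← ZMod.natCast_eq_zero_iff, PD_two_cast_eq hn]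
  have h22 : (2 : ZMod 4) + 2 = 0 := rfl
  have h2 : (2 : ZMod 4) * 2 = 0 := rfl
  have h1 : (2 : ZMod 4) * (-1) + 2 * (-1) = 0 := rfl
  have hpair {a b : ℕ} (hab : n = a ^ 2 + b ^ 2) :
      3 ∣ n ∧ 3 ∣ a ∧ 3 ∣ b ∨ n % 12 = 5 ∧ ¬ 3 ∣ a ∧ ¬ 3 ∣ b := by
    rcases h with h | h
    · exact Or.inl ⟨h, three_dvd_of_three_dvd_sq_add_sq (hab ▸ h)⟩
    · have := sq_mod_twelve a
      have := sq_mod_twelve b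
      omega
  rw [sum_eq_zero, zero_add]
  · refine sum_involution (fun p _ ↦ p.swap) ?_ ?_ ?_ ?_
    · rintro ⟨a, b⟩ -
      simp only [Prod.fst_swap, Prod.snd_swap, add_comm (b ^ 2)]
      split_ifs with hab
      · rcases hpair hab with ⟨-, ha, hb⟩ | ⟨-, ha, hb⟩
        · rw [cubicTrace_of_dvd ha, cubicTrace_of_dvd hb, h2, add_zero]
        · rw [cubicTrace_of_not_dvd ha, cubicTrace_of_not_dvd hb, h1]
      · exact add_zero 0
    · rintro ⟨a, b⟩ - hne hswap
      obtain rfl : b = a := congrArg Prod.fst hswap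
      refine hne (ite_eq_right_iff.2 fun hab ↦ ?_)
      rcases hpair hab with ⟨-, ha, -⟩ | ⟨h5, -⟩
      · rw [cubicTrace_of_dvd ha, h2]
      · simp only at hab
        omega
    · rintro ⟨a, b⟩ hp
      simpa [and_comm] using hp
    · rintro ⟨a, b⟩ -
      rfl
  · intro k _
    refine ite_eq_right_iff.2 fun hk ↦ ?_
    have := sq_mod_twelve k
    rw [cubicTrace_of_dvd (by omega), h22]

theorem stmt_12 :
    (∀ n : ℕ, 1 ≤ n → PD 2 (3 * n) % 4 = 0) ∧
    (∀ n : ℕ, 1 ≤ n → ¬ 6 ∣ n → PD 2 (2 * n + 1) % 4 = 0) :=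
  ⟨fun _ _ ↦ PD_two_mod_four (by omega) (by omega),
    fun n _ _ ↦ PD_two_mod_four (by omega) (by
      have : n % 6 = 1 ∨ n % 6 = 2 ∨ n % 6 = 3 ∨ n % 6 = 4 ∨ n % 6 = 5 := by omega
      omega)⟩
end
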